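/- arXiv:2112.02371 — 5 statements merged into one kernel-verified Lean document; each statement's English description precedes it below -/
import Mathlib

section
/- Let f : (Y,d_Y) → (Z,d_Z) be a locally bi-Lipschitz map between metric spaces and let K ⊆ Y be a compact set such that the restriction f|_K : K → f(K) is a homeomorphism onto its image. Then f|_K is bi-Lipschitz: there exists L ≥ 1 such that L^{-1}·d_Y(x,y) ≤ d_Z(f(x),f(y)) ≤ L·d_Y(x,y) for all x,y ∈ K. -/
open Filter Topology

/-- A map that is Lipschitz near every point is continuous. -/
lemma continuous_of_forall_exists_isOpen_dist_le {Y Z : Type*} [MetricSpace Y] [MetricSpace Z]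
    {f : Y → Z}
    (hf : ∀ y : Y, ∃ U : Set Y, IsOpen U ∧ y ∈ U ∧ ∃ L : ℝ,
      ∀ x ∈ U, ∀ x' ∈ U, dist (f x) (f x') ≤ L * dist x x') :
    Continuous f := by
  rw [continuous_iff_continuousAt]
  intro y
  obtain ⟨U, hU, hy, L, hL⟩ := hf y
  refine (LipschitzOnWith.of_dist_le' (K := L) hL).continuousOn.continuousAt (hU.mem_nhds hy)

/-- Near a pair of distinct points with distinct images, a continuous map distorts distances
by a bounded factor. -/
lemma Continuous.exists_eventually_dist_le_of_ne {Y Z : Type*} [MetricSpace Y] [MetricSpace Z]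
    {f : Y → Z} (hf : Continuous f) {a b : Y} (hab : a ≠ b) (hfab : f a ≠ f b) :
    ∃ L : ℝ, 1 ≤ L ∧ ∀ᶠ p in 𝓝 (a, b),
      dist p.1 p.2 ≤ L * dist (f p.1) (f p.2) ∧ dist (f p.1) (f p.2) ≤ L * dist p.1 p.2 := by
  have hd : 0 < dist a b := dist_pos.2 hab
  have hfd : 0 < dist (f a) (f b) := dist_pos.2 hfab
  obtain ⟨L, hL⟩ := exists_gt
    (max 1 (max (dist a b / dist (f a) (f b)) (dist (f a) (f b) / dist a b)))
  simp only [max_lt_iff, div_lt_iff₀ hd, div_lt_iff₀ hfd] at hL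
  obtain ⟨h1, h2, h3⟩ := hL
  have hc : Continuous fun p : Y × Y => dist p.1 p.2 := by fun_prop
  have hfc : Continuous fun p : Y × Y => dist (f p.1) (f p.2) := by fun_prop
  refine ⟨L, h1.le, ?_⟩
  filter_upwards [hc.continuousAt.eventually_lt (hfc.const_mul L).continuousAt h2,
    hfc.continuousAt.eventually_lt (hc.const_mul L).continuousAt h3] with p hp hfp
  exact ⟨hp.le, hfp.le⟩

/-- A locally bi-Lipschitz map between metric spaces whose restriction to a
compact set `K` is a homeomorphism onto its image is bi-Lipschitz on `K`. -/
theorem locally_biLipschitz_restriction_biLipschitz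
    {Y Z : Type*} [MetricSpace Y] [MetricSpace Z] (f : Y → Z)
    (hloc : ∀ y : Y, ∃ U : Set Y, IsOpen U ∧ y ∈ U ∧ ∃ L : ℝ, 1 ≤ L ∧
      ∀ x ∈ U, ∀ x' ∈ U,
        L⁻¹ * dist x x' ≤ dist (f x) (f x') ∧ dist (f x) (f x') ≤ L * dist x x')
    (K : Set Y) (hK : IsCompact K)
    (hhomeo : ∃ h : K ≃ₜ (f '' K), ∀ x : K, (h x : Z) = f x) :
    ∃ L : ℝ, 1 ≤ L ∧ ∀ x ∈ K, ∀ x' ∈ K,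
      L⁻¹ * dist x x' ≤ dist (f x) (f x') ∧ dist (f x) (f x') ≤ L * dist x x' := by
  obtain ⟨h, hh⟩ := hhomeo
  have hinj : Set.InjOn f K := fun x hx y hy hxy => by
    have : h ⟨x, hx⟩ = h ⟨y, hy⟩ := Subtype.ext (by rw [hh, hh]; exact hxy)
    exact congrArg Subtype.val (h.injective this)
  have hf : Continuous f := continuous_of_forall_exists_isOpen_dist_le fun y => by
    obtain ⟨U, hU, hy, L, -, hL⟩ := hloc y
    exact ⟨U, hU, hy, L, fun x hx x' hx' => (hL x hx x' hx').2⟩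
  have key : ∃ L : ℝ, 1 ≤ L ∧ ∀ p ∈ K ×ˢ K,
      dist p.1 p.2 ≤ L * dist (f p.1) (f p.2) ∧ dist (f p.1) (f p.2) ≤ L * dist p.1 p.2 := by
    refine (hK.prod hK).induction_on (p := fun S => ∃ L : ℝ, 1 ≤ L ∧ ∀ p ∈ S,
      dist p.1 p.2 ≤ L * dist (f p.1) (f p.2) ∧ dist (f p.1) (f p.2) ≤ L * dist p.1 p.2)
      ⟨1, le_rfl, by simp⟩ ?_ ?_ ?_
    · rintro S T hST ⟨L, hL, hT⟩
      exact ⟨L, hL, fun p hp => hT p (hST hp)⟩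
    · rintro S T ⟨L, hL, hS⟩ ⟨M, hM, hT⟩
      refine ⟨max L M, hL.trans (le_max_left _ _), ?_⟩
      rintro p (hp | hp)
      · exact ⟨(hS p hp).1.trans (by gcongr; exact le_max_left _ _),
          (hS p hp).2.trans (by gcongr; exact le_max_left _ _)⟩
      · exact ⟨(hT p hp).1.trans (by gcongr; exact le_max_right _ _),
          (hT p hp).2.trans (by gcongr; exact le_max_right _ _)⟩
    · rintro ⟨a, b⟩ ⟨ha, hb⟩
      by_cases hab : a = b
      · subst hab
        obtain ⟨U, hU, haU, L, hL, hUL⟩ := hloc a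
        refine ⟨U ×ˢ U, mem_nhdsWithin_of_mem_nhds
          (prod_mem_nhds (hU.mem_nhds haU) (hU.mem_nhds haU)), L, hL, ?_⟩
        rintro p ⟨hp1, hp2⟩
        obtain ⟨hl, hr⟩ := hUL _ hp1 _ hp2
        exact ⟨(inv_mul_le_iff₀ (by linarith)).1 hl, hr⟩
      · obtain ⟨L, hL, hev⟩ :=
          hf.exists_eventually_dist_le_of_ne hab fun hfab => hab (hinj ha hb hfab)
        exact ⟨_, mem_nhdsWithin_of_mem_nhds hev, L, hL, fun p hp => hp⟩
  obtain ⟨L, hL, hKL⟩ := key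
  refine ⟨L, hL, fun x hx x' hx' => ?_⟩
  obtain ⟨hl, hr⟩ := hKL (x, x') ⟨hx, hx'⟩
  exact ⟨(inv_mul_le_iff₀ (by linarith)).2 hl, hr⟩
end

section
/- Let H be a complex Hilbert space, let p ∈ (0,1), and let S, T ∈ B(H) with [S,T] = ST − TS ∈ L^p(H). Then for every function f holomorphic in an open neighbourhood of the spectrum σ(S), the commutator [f(S), T] lies in L^p(H). -/
open MeasureTheory

variable {H : Type*} [NormedAddCommGroup H] [InnerProductSpace ℂ H] [CompleteSpace H]

/-- The `n`-th singular value (approximation number) of an operator `T`: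
`s_n(T) = inf {‖T − R‖ : rank R < n}`. -/
noncomputable def singularValue {E : Type*} [NormedAddCommGroup E] [NormedSpace ℂ E]
    (T : E →L[ℂ] E) (n : ℕ) : ℝ :=
  sInf {r : ℝ | ∃ R : E →L[ℂ] E, LinearMap.rank (R : E →ₗ[ℂ] E) < (n : Cardinal) ∧ ‖T - R‖ = r}

/-- Membership in the Schatten `p`-ideal `L^p(H)`: `T` is compact and its singular values
are `p`-summable. -/
def MemSchatten {E : Type*} [NormedAddCommGroup E] [NormedSpace ℂ E]
    (p : ℝ) (T : E →L[ℂ] E) : Prop :=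
  IsCompactOperator T ∧ Summable (fun n : ℕ => singularValue T n ^ p)

/-- The contour integral `∮_Γ g(z) dz` of a scalar function along a finite system of
parametrized closed `C¹`-curves `γ k : [0,1] → ℂ`. -/
noncomputable def contourIntC (mΓ : ℕ) (γ : Fin mΓ → ℝ → ℂ) (g : ℂ → ℂ) : ℂ :=
  ∑ k, ∫ t in (0:ℝ)..1, g (γ k t) * deriv (γ k) t

/-- The Riesz–Dunford integral `(2πi)⁻¹ ∮_Γ g(z) (z·1 − S)⁻¹ dz` of `g` along a finite system
of parametrized closed `C¹`-curves. -/
noncomputable def dunfordIntegral (mΓ : ℕ) (γ : Fin mΓ → ℝ → ℂ) (S : H →L[ℂ] H)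
    (g : ℂ → ℂ) : H →L[ℂ] H :=
  (2 * Real.pi * Complex.I : ℂ)⁻¹ •
    ∑ k, ∫ t in (0:ℝ)..1, (g (γ k t) * deriv (γ k) t) •
      Ring.inverse ((γ k t) • (1 : H →L[ℂ] H) - S)

section SingularValue

variable {E : Type*} [NormedAddCommGroup E] [NormedSpace ℂ E]

theorem singularValue_nonneg (T : E →L[ℂ] E) (n : ℕ) : 0 ≤ singularValue T n :=
  Real.sInf_nonneg (by rintro _ ⟨R, -, rfl⟩; exact norm_nonneg _)

theorem singularValue_succ_le {T R : E →L[ℂ] E} {n : ℕ}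
    (hR : LinearMap.rank (R : E →ₗ[ℂ] E) ≤ (n : Cardinal)) :
    singularValue T (n + 1) ≤ ‖T - R‖ :=
  csInf_le ⟨0, by rintro _ ⟨R, -, rfl⟩; exact norm_nonneg _⟩
    ⟨R, by push_cast; exact Cardinal.lt_natCast_add_one_iff.2 hR, rfl⟩

theorem exists_rank_le_norm_sub_lt (T : E →L[ℂ] E) (n : ℕ) {ε : ℝ} (hε : 0 < ε) :
    ∃ R : E →L[ℂ] E, LinearMap.rank (R : E →ₗ[ℂ] E) ≤ (n : Cardinal) ∧
      ‖T - R‖ < singularValue T (n + 1) + ε := by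
  have hne : {r : ℝ | ∃ R : E →L[ℂ] E,
      LinearMap.rank (R : E →ₗ[ℂ] E) < ((n + 1 : ℕ) : Cardinal) ∧ ‖T - R‖ = r}.Nonempty := by
    refine ⟨‖T - 0‖, 0, ?_, rfl⟩
    push_cast
    exact Cardinal.lt_natCast_add_one_iff.2 (by simp)
  obtain ⟨_, ⟨R, hR, rfl⟩, hlt⟩ := Real.lt_sInf_add_pos hne hε
  refine ⟨R, ?_, hlt⟩
  push_cast at hR
  exact Cardinal.lt_natCast_add_one_iff.1 hR

theorem singularValue_succ_le_norm (T : E →L[ℂ] E) (n : ℕ) : singularValue T (n + 1) ≤ ‖T‖ := by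
  simpa using singularValue_succ_le (T := T) (R := 0) (n := n) (by simp)

theorem singularValue_succ_antitone (T : E →L[ℂ] E) :
    Antitone fun n : ℕ => singularValue T (n + 1) := by
  intro m n hmn
  refine le_of_forall_pos_lt_add fun ε hε => ?_
  obtain ⟨R, hR, hlt⟩ := exists_rank_le_norm_sub_lt T m hε
  exact (singularValue_succ_le (hR.trans (by exact_mod_cast hmn))).trans_lt hlt

theorem singularValue_add_le (X Y : E →L[ℂ] E) (m n : ℕ) :
    singularValue (X + Y) (m + n + 1) ≤ singularValue X (m + 1) + singularValue Y (n + 1) := by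
  refine le_of_forall_pos_le_add fun ε hε => ?_
  obtain ⟨P, hP, hPlt⟩ := exists_rank_le_norm_sub_lt X m (half_pos hε)
  obtain ⟨Q, hQ, hQlt⟩ := exists_rank_le_norm_sub_lt Y n (half_pos hε)
  have hPQ : LinearMap.rank ((P + Q : E →L[ℂ] E) : E →ₗ[ℂ] E) ≤ ((m + n : ℕ) : Cardinal) := by
    push_cast
    exact (LinearMap.rank_add_le _ _).trans (add_le_add hP hQ)
  have h := singularValue_succ_le (T := X + Y) hPQ
  have h' : ‖X + Y - (P + Q)‖ ≤ ‖X - P‖ + ‖Y - Q‖ := by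
    rw [add_sub_add_comm]
    exact norm_add_le _ _
  linarith

theorem singularValue_mul_mul_le (U A V : E →L[ℂ] E) (n : ℕ) :
    singularValue (U * A * V) (n + 1) ≤ ‖U‖ * ‖V‖ * singularValue A (n + 1) := by
  have key : ∀ ε > 0, singularValue (U * A * V) (n + 1) ≤
      ‖U‖ * ‖V‖ * (singularValue A (n + 1) + ε) := by
    intro ε hε
    obtain ⟨R, hR, hlt⟩ := exists_rank_le_norm_sub_lt A n hε
    have hrank : LinearMap.rank ((U * R * V : E →L[ℂ] E) : E →ₗ[ℂ] E) ≤ (n : Cardinal) :=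
      ((LinearMap.rank_comp_le_left (V : E →ₗ[ℂ] E) ((U * R : E →L[ℂ] E) : E →ₗ[ℂ] E)).trans
        (LinearMap.rank_comp_le_right (R : E →ₗ[ℂ] E) (U : E →ₗ[ℂ] E))).trans hR
    calc singularValue (U * A * V) (n + 1) ≤ ‖U * A * V - U * R * V‖ :=
          singularValue_succ_le hrank
      _ = ‖U * (A - R) * V‖ := by rw [mul_sub, sub_mul]
      _ ≤ ‖U‖ * ‖A - R‖ * ‖V‖ := (norm_mul_le _ _).trans (by gcongr; exact norm_mul_le _ _)
      _ = ‖U‖ * ‖V‖ * ‖A - R‖ := by ring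
      _ ≤ _ := by gcongr
  have hlim : Filter.Tendsto (fun ε : ℝ => ‖U‖ * ‖V‖ * (singularValue A (n + 1) + ε))
      (nhdsWithin 0 (Set.Ioi 0)) (nhds (‖U‖ * ‖V‖ * (singularValue A (n + 1) + 0))) :=
    (Continuous.tendsto (by fun_prop) 0).mono_left nhdsWithin_le_nhds
  rw [add_zero] at hlim
  exact ge_of_tendsto hlim (eventually_nhdsWithin_of_forall key)

theorem singularValue_sum_le (B : ℕ → E →L[ℂ] E) (m : ℕ → ℕ) (J : ℕ) :
    singularValue (∑ j ∈ Finset.range J, B j) (∑ j ∈ Finset.range J, m j + 1) ≤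
      ∑ j ∈ Finset.range J, singularValue (B j) (m j + 1) := by
  induction J with
  | zero => simpa using singularValue_succ_le_norm (0 : E →L[ℂ] E) 0
  | succ J ih =>
    rw [Finset.sum_range_succ, Finset.sum_range_succ, Finset.sum_range_succ]
    exact (singularValue_add_le _ _ _ _).trans (by gcongr)

end SingularValue

theorem sum_range_mul_div (g : ℕ → ℝ) {q : ℕ} (hq : 0 < q) (M : ℕ) :
    ∑ m ∈ Finset.range (M * q), g (m / q) = q * ∑ m ∈ Finset.range M, g m := by
  induction M with
  | zero => simp
  | succ M ih =>
    rw [Nat.succ_mul, Finset.sum_range_add, ih, Finset.sum_range_succ, mul_add]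
    congr 1
    rw [Finset.sum_congr rfl (g := fun _ => g M), Finset.sum_const, Finset.card_range, nsmul_eq_mul]
    intro i hi
    rw [mul_comm M q, Nat.mul_add_div hq, Nat.div_eq_of_lt (Finset.mem_range.1 hi), add_zero]

theorem sum_range_div_le {g : ℕ → ℝ} (h0 : ∀ n, 0 ≤ g n) (hg : Summable g) {q : ℕ} (hq : 0 < q)
    (M : ℕ) : ∑ m ∈ Finset.range M, g (m / q) ≤ q * ∑' m, g m :=
  calc ∑ m ∈ Finset.range M, g (m / q) ≤ ∑ m ∈ Finset.range (M * q), g (m / q) :=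
        Finset.sum_le_sum_of_subset_of_nonneg
          (Finset.range_mono (Nat.le_mul_of_pos_right M hq)) fun _ _ _ => h0 _
    _ = q * ∑ m ∈ Finset.range M, g m := sum_range_mul_div g hq M
    _ ≤ q * ∑' m, g m := by gcongr; exact hg.sum_le_tsum _ fun _ _ => h0 _

theorem rpow_sum_range_le_sum_rpow {p : ℝ} (hp0 : 0 < p) (hp1 : p ≤ 1) {a : ℕ → ℝ}
    (ha : ∀ j, 0 ≤ a j) (J : ℕ) :
    (∑ j ∈ Finset.range J, a j) ^ p ≤ ∑ j ∈ Finset.range J, a j ^ p := by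
  induction J with
  | zero => simp [Real.zero_rpow hp0.ne']
  | succ J ih =>
    rw [Finset.sum_range_succ, Finset.sum_range_succ]
    exact (Real.rpow_add_le_add_rpow (Finset.sum_nonneg fun j _ => ha j) (ha J) hp0.le hp1).trans
      (by gcongr)

theorem sum_range_div_two_pow_le (m J : ℕ) : ∑ j ∈ Finset.range J, m / 2 ^ (j + 1) ≤ m := by
  have h : ∀ J, ∑ j ∈ Finset.range J, m / 2 ^ (j + 1) + m / 2 ^ J ≤ m := by
    intro J
    induction J with
    | zero => simp
    | succ J ih =>
      rw [Finset.sum_range_succ]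
      have : m / 2 ^ (J + 1) = m / 2 ^ J / 2 := by rw [pow_succ, Nat.div_div_eq_div_mul]
      omega
  exact (Nat.le_add_right _ _).trans (h J)

section Schatten

variable {E : Type*} [NormedAddCommGroup E] [NormedSpace ℂ E] {p : ℝ}

theorem memSchatten_iff_succ {T : E →L[ℂ] E} :
    MemSchatten p T ↔
      IsCompactOperator T ∧ Summable fun n : ℕ => singularValue T (n + 1) ^ p :=
  and_congr_right fun _ => (summable_nat_add_iff (f := fun n => singularValue T n ^ p) 1).symm

theorem MemSchatten.mul_mul (hp0 : 0 < p) {A : E →L[ℂ] E} (hA : MemSchatten p A)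
    (U V : E →L[ℂ] E) : MemSchatten p (U * A * V) := by
  rw [memSchatten_iff_succ] at hA ⊢
  refine ⟨(hA.1.clm_comp U).comp_clm V, ?_⟩
  refine Summable.of_nonneg_of_le (fun n => Real.rpow_nonneg (singularValue_nonneg _ _) _)
    (fun n => ?_) (hA.2.mul_left ((‖U‖ * ‖V‖) ^ p))
  rw [← Real.mul_rpow (by positivity) (singularValue_nonneg _ _)]
  exact Real.rpow_le_rpow (singularValue_nonneg _ _) (singularValue_mul_mul_le U A V n) hp0.le

theorem MemSchatten.smul (hp0 : 0 < p) {A : E →L[ℂ] E} (hA : MemSchatten p A) (c : ℂ) :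
    MemSchatten p (c • A) := by
  simpa using hA.mul_mul hp0 (c • 1) 1

theorem memSchatten_zero (hp0 : 0 < p) : MemSchatten p (0 : E →L[ℂ] E) := by
  refine memSchatten_iff_succ.2 ⟨isCompactOperator_zero, ?_⟩
  have h : ∀ n : ℕ, singularValue (0 : E →L[ℂ] E) (n + 1) = 0 := fun n =>
    le_antisymm (by simpa using singularValue_succ_le_norm (0 : E →L[ℂ] E) n)
      (singularValue_nonneg _ _)
  simp [h, Real.zero_rpow hp0.ne']

theorem MemSchatten.add (hp0 : 0 < p) (hp1 : p ≤ 1) {X Y : E →L[ℂ] E} (hX : MemSchatten p X)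
    (hY : MemSchatten p Y) : MemSchatten p (X + Y) := by
  rw [memSchatten_iff_succ] at hX hY ⊢
  refine ⟨hX.1.add hY.1, ?_⟩
  have hdiv : ∀ {Z : E →L[ℂ] E}, Summable (fun n : ℕ => singularValue Z (n + 1) ^ p) →
      Summable fun n : ℕ => singularValue Z (n / 2 + 1) ^ p := fun {Z} hZ =>
    summable_of_sum_range_le (fun n => Real.rpow_nonneg (singularValue_nonneg _ _) _)
      (sum_range_div_le (fun n => Real.rpow_nonneg (singularValue_nonneg _ _) _) hZ two_pos)
  refine Summable.of_nonneg_of_le (fun n => Real.rpow_nonneg (singularValue_nonneg _ _) _)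
    (fun n => ?_) ((hdiv hX.2).add (hdiv hY.2))
  refine (Real.rpow_le_rpow (singularValue_nonneg _ _) ?_ hp0.le).trans
    (Real.rpow_add_le_add_rpow (singularValue_nonneg _ _) (singularValue_nonneg _ _) hp0.le hp1)
  exact (singularValue_succ_antitone (X + Y) (by omega : n / 2 + n / 2 ≤ n)).trans
    (singularValue_add_le X Y _ _)

theorem MemSchatten.sum (hp0 : 0 < p) (hp1 : p ≤ 1) {ι : Type*} (s : Finset ι)
    {X : ι → E →L[ℂ] E} (hX : ∀ i ∈ s, MemSchatten p (X i)) : MemSchatten p (∑ i ∈ s, X i) :=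
  Finset.sum_induction X (MemSchatten p) (fun _ _ => MemSchatten.add hp0 hp1)
    (memSchatten_zero hp0) hX

/-- An operator approximated at a geometric rate by the partial sums of `∑ U j * A * V j`, where
`‖U j‖ * ‖V j‖` decays at the same rate, is in `L^p` if `A` is, provided that the rate `δ`
satisfies `2 * δ ^ p < 1`. -/
theorem MemSchatten.of_geometric_approx [CompleteSpace E] (hp0 : 0 < p) (hp1 : p ≤ 1)
    {A X : E →L[ℂ] E} (hA : MemSchatten p A) (U V : ℕ → E →L[ℂ] E) {C D δ : ℝ} (hδ0 : 0 ≤ δ)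
    (hδ : 2 * δ ^ p < 1) (hUV : ∀ j, ‖U j‖ * ‖V j‖ ≤ C * δ ^ j)
    (hX : ∀ J, ‖X - ∑ j ∈ Finset.range J, U j * A * V j‖ ≤ D * δ ^ J) : MemSchatten p X := by
  have hC : 0 ≤ C := by simpa using (by positivity : 0 ≤ ‖U 0‖ * ‖V 0‖).trans (hUV 0)
  have hD : 0 ≤ D := by simpa using (norm_nonneg _).trans (hX 0)
  have hδp0 : 0 ≤ δ ^ p := Real.rpow_nonneg hδ0 p
  have hδ1 : δ < 1 := by
    by_contra! h
    linarith [Real.one_le_rpow h hp0.le]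
  rw [memSchatten_iff_succ] at hA ⊢
  have hnn : ∀ n, 0 ≤ singularValue A (n + 1) ^ p := fun n =>
    Real.rpow_nonneg (singularValue_nonneg _ _) _
  refine ⟨?_, summable_of_sum_range_le (c := C ^ p * (2 * ∑' n, singularValue A (n + 1) ^ p) *
    (1 - 2 * δ ^ p)⁻¹) (fun n => Real.rpow_nonneg (singularValue_nonneg _ _) _) fun M => ?_⟩
  · refine isCompactOperator_of_tendsto (l := Filter.atTop)
      (F := fun J => ∑ j ∈ Finset.range J, U j * A * V j) ?_ (Filter.Eventually.of_forall fun J => ?_)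
    · rw [tendsto_iff_norm_sub_tendsto_zero]
      refine squeeze_zero (fun _ => norm_nonneg _)
        (fun J => (norm_sub_rev _ _).le.trans (hX J)) ?_
      simpa using (tendsto_pow_atTop_nhds_zero_of_lt_one hδ0 hδ1).const_mul D
    · exact Finset.sum_induction (fun j => U j * A * V j) (fun B => IsCompactOperator B)
        (fun _ _ h₁ h₂ => h₁.add h₂) isCompactOperator_zero
        fun j _ => (hA.1.clm_comp (U j)).comp_clm (V j)
  have hsv : ∀ J n, singularValue X (n + 1) ≤
      ∑ j ∈ Finset.range J, C * δ ^ j * singularValue A (n / 2 ^ (j + 1) + 1) + D * δ ^ J := by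
    intro J n
    have h1 := singularValue_add_le (∑ j ∈ Finset.range J, U j * A * V j)
      (X - ∑ j ∈ Finset.range J, U j * A * V j) (∑ j ∈ Finset.range J, n / 2 ^ (j + 1)) 0
    rw [add_sub_cancel, add_zero] at h1
    refine ((singularValue_succ_antitone X (sum_range_div_two_pow_le n J)).trans h1).trans
      (add_le_add ((singularValue_sum_le _ _ _).trans (Finset.sum_le_sum fun j _ => ?_))
        ((singularValue_succ_le_norm _ _).trans (hX J)))
    exact (singularValue_mul_mul_le _ _ _ _).trans
      (mul_le_mul_of_nonneg_right (hUV j) (singularValue_nonneg _ _))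
  have hpow : ∀ J : ℕ, (δ ^ J) ^ p = (δ ^ p) ^ J := fun J => by
    rw [← Real.rpow_natCast, ← Real.rpow_natCast, ← Real.rpow_mul hδ0, ← Real.rpow_mul hδ0,
      mul_comm]
  have hsvp : ∀ J n, singularValue X (n + 1) ^ p ≤
      ∑ j ∈ Finset.range J, C ^ p * (δ ^ p) ^ j * singularValue A (n / 2 ^ (j + 1) + 1) ^ p +
        D ^ p * (δ ^ p) ^ J := by
    intro J n
    have hterm : ∀ j, 0 ≤ C * δ ^ j * singularValue A (n / 2 ^ (j + 1) + 1) := fun j =>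
      mul_nonneg (by positivity) (singularValue_nonneg _ _)
    refine (Real.rpow_le_rpow (singularValue_nonneg _ _) (hsv J n) hp0.le).trans ?_
    refine (Real.rpow_add_le_add_rpow (Finset.sum_nonneg fun j _ => hterm j) (by positivity)
      hp0.le hp1).trans (add_le_add ?_ ?_)
    · refine (rpow_sum_range_le_sum_rpow hp0 hp1 hterm J).trans_eq
        (Finset.sum_congr rfl fun j _ => ?_)
      rw [Real.mul_rpow (by positivity) (singularValue_nonneg _ _),
        Real.mul_rpow hC (by positivity), hpow]
    · rw [Real.mul_rpow hD (by positivity), hpow]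
  have hbound : ∀ J, ∑ n ∈ Finset.range M, singularValue X (n + 1) ^ p ≤
      C ^ p * (2 * ∑' n, singularValue A (n + 1) ^ p) * (1 - 2 * δ ^ p)⁻¹ +
        M * (D ^ p * (δ ^ p) ^ J) := by
    intro J
    refine (Finset.sum_le_sum fun n _ => hsvp J n).trans ?_
    rw [Finset.sum_add_distrib, Finset.sum_const, Finset.card_range, nsmul_eq_mul,
      Finset.sum_comm]
    gcongr
    have hgeom : ∑ j ∈ Finset.range J, (2 * δ ^ p) ^ j ≤ (1 - 2 * δ ^ p)⁻¹ := by
      rw [← tsum_geometric_of_lt_one (by positivity) hδ]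
      exact (summable_geometric_of_lt_one (by positivity) hδ).sum_le_tsum _
        fun _ _ => by positivity
    calc _ ≤ ∑ j ∈ Finset.range J,
          C ^ p * (2 * ∑' n, singularValue A (n + 1) ^ p) * (2 * δ ^ p) ^ j := by
          refine Finset.sum_le_sum fun j _ => ?_
          rw [← Finset.mul_sum]
          refine (mul_le_mul_of_nonneg_left (sum_range_div_le hnn hA.2
            (by positivity : 0 < 2 ^ (j + 1)) M) (by positivity)).trans_eq ?_
          push_cast
          ring
      _ ≤ _ := by
          rw [← Finset.mul_sum]
          exact mul_le_mul_of_nonneg_left hgeom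
            (mul_nonneg (by positivity) (mul_nonneg zero_le_two (tsum_nonneg hnn)))
  have hlim : Filter.Tendsto (fun J : ℕ =>
      C ^ p * (2 * ∑' n, singularValue A (n + 1) ^ p) * (1 - 2 * δ ^ p)⁻¹ +
        M * (D ^ p * (δ ^ p) ^ J)) Filter.atTop
      (nhds (C ^ p * (2 * ∑' n, singularValue A (n + 1) ^ p) * (1 - 2 * δ ^ p)⁻¹ +
        M * (D ^ p * 0))) :=
    (((tendsto_pow_atTop_nhds_zero_of_lt_one hδp0 (by linarith)).const_mul _).const_mul _).const_add
      _
  simpa using ge_of_tendsto' hlim hbound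

end Schatten

section ResolventIntegral

theorem norm_pow_mul_le {𝔸 : Type*} [SeminormedRing 𝔸] {a : 𝔸} {K : ℝ} (hK : 0 ≤ K) (ha : ‖a‖ ≤ K)
    (x : 𝔸) (J : ℕ) : ‖a ^ J * x‖ ≤ K ^ J * ‖x‖ := by
  induction J with
  | zero => simp
  | succ J ih =>
    rw [pow_succ', mul_assoc, pow_succ', mul_assoc]
    exact (norm_mul_le _ _).trans (by gcongr)

variable {E : Type*} [NormedAddCommGroup E] [NormedSpace ℂ E] {p : ℝ}

theorem isUnit_smul_one_sub {S : E →L[ℂ] E} {z : ℂ} (hz : z ∉ spectrum ℂ S) :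
    IsUnit (z • (1 : E →L[ℂ] E) - S) := by
  rw [← Algebra.algebraMap_eq_smul_one]
  exact spectrum.notMem_iff.1 hz

variable [CompleteSpace E]

/-- If `r` satisfies the resolvent identity with base value `r₀` on a short interval, then the
integral of `c • (r * A * r)` over that interval is in `L^p` whenever `A` is. -/
theorem MemSchatten.integral_of_resolvent_identity (hp0 : 0 < p) (hp1 : p ≤ 1) {A : E →L[ℂ] E}
    (hA : MemSchatten p A) {a b : ℝ} (hab : a ≤ b) {r : ℝ → E →L[ℂ] E} {r₀ : E →L[ℂ] E}
    {c ζ : ℝ → ℂ} {K L ρ : ℝ} (hr : ContinuousOn r (Set.Icc a b))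
    (hc : ContinuousOn c (Set.Icc a b)) (hζ : ContinuousOn ζ (Set.Icc a b))
    (hid : ∀ t ∈ Set.Icc a b, r t = r₀ + ζ t • (r₀ * r t))
    (hr₀K : ‖r₀‖ ≤ K) (hrK : ∀ t ∈ Set.Icc a b, ‖r t‖ ≤ K) (hcL : ∀ t ∈ Set.Icc a b, ‖c t‖ ≤ L)
    (hζρ : ∀ t ∈ Set.Icc a b, ‖ζ t‖ ≤ ρ) (hKρ : 2 * (K * ρ) ^ p < 1) :
    MemSchatten p (∫ t in a..b, c t • (r t * A * r t)) := by
  have haI : a ∈ Set.Icc a b := Set.left_mem_Icc.2 hab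
  have hK : 0 ≤ K := (norm_nonneg _).trans hr₀K
  have hL : 0 ≤ L := (norm_nonneg _).trans (hcL a haI)
  have hρ : 0 ≤ ρ := (norm_nonneg _).trans (hζρ a haI)
  have huIoc : ∀ t ∈ Set.uIoc a b, t ∈ Set.Icc a b := fun t ht => by
    rw [Set.uIoc_of_le hab] at ht
    exact Set.Ioc_subset_Icc_self ht
  have hint : ∀ {g : ℝ → E →L[ℂ] E}, ContinuousOn g (Set.Icc a b) →
      IntervalIntegrable g volume a b := fun hg => hg.intervalIntegrable_of_Icc hab
  set Q : ℕ → E →L[ℂ] E := fun j => ∫ t in a..b, (c t * ζ t ^ j) • r t with hQ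
  set D : ℕ → E →L[ℂ] E := fun J => ∫ t in a..b, (c t * ζ t ^ J) • (r₀ ^ J * r t * A * r t) with hD
  have hstep : ∀ J, D J = r₀ ^ (J + 1) * A * Q J + D (J + 1) := by
    intro J
    have hmul : r₀ ^ (J + 1) * A * Q J =
        ∫ t in a..b, (c t * ζ t ^ J) • (r₀ ^ (J + 1) * A * r t) := by
      rw [hQ]
      have h := (ContinuousLinearMap.mul ℂ (E →L[ℂ] E)
        (r₀ ^ (J + 1) * A)).intervalIntegral_comp_comm (hint (g := fun t => (c t * ζ t ^ J) • r t) (by fun_prop))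
      simpa using h.symm
    rw [hmul, hD, ← intervalIntegral.integral_add (hint (by fun_prop)) (hint (by fun_prop))]
    refine intervalIntegral.integral_congr fun t ht => ?_
    rw [Set.uIcc_of_le hab] at ht
    have h : r₀ ^ J * r t = r₀ ^ (J + 1) + ζ t • (r₀ ^ (J + 1) * r t) := by
      conv_lhs => rw [hid t ht]
      rw [mul_add, mul_smul_comm, ← mul_assoc, ← pow_succ]
    simp only [h, add_mul, smul_mul_assoc, smul_add, smul_smul, pow_succ, mul_assoc]
  have hsum : ∀ J, D 0 - ∑ j ∈ Finset.range J, r₀ ^ (j + 1) * A * Q j = D J := by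
    intro J
    induction J with
    | zero => simp
    | succ J ih => rw [Finset.sum_range_succ, ← sub_sub, ih, hstep J, add_sub_cancel_left]
  have hD0 : ∫ t in a..b, c t • (r t * A * r t) = D 0 := by simp [hD]
  rw [hD0]
  refine hA.of_geometric_approx hp0 hp1 (fun j => r₀ ^ (j + 1)) Q (C := K * (L * K * |b - a|))
    (D := L * (K * ‖A‖ * K) * |b - a|) (mul_nonneg hK hρ) hKρ (fun j => ?_) fun J => ?_
  · have h1 : ‖r₀ ^ (j + 1)‖ ≤ K ^ (j + 1) :=
      (norm_pow_le' _ j.succ_pos).trans (by gcongr)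
    have h2 : ‖Q j‖ ≤ L * ρ ^ j * K * |b - a| := by
      refine intervalIntegral.norm_integral_le_of_norm_le_const fun t ht => ?_
      rw [norm_smul, norm_mul, norm_pow]
      have := hrK t (huIoc t ht)
      have := hcL t (huIoc t ht)
      have := hζρ t (huIoc t ht)
      gcongr
    calc _ ≤ K ^ (j + 1) * (L * ρ ^ j * K * |b - a|) := by gcongr
      _ = _ := by ring
  · rw [hsum J]
    have h : ‖D J‖ ≤ L * ρ ^ J * (K ^ J * K * ‖A‖ * K) * |b - a| := by
      refine intervalIntegral.norm_integral_le_of_norm_le_const fun t ht => ?_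
      have h1 := hrK t (huIoc t ht)
      have h2 := hcL t (huIoc t ht)
      have h3 := hζρ t (huIoc t ht)
      rw [norm_smul, norm_mul, norm_pow]
      gcongr
      refine (norm_mul_le _ _).trans (mul_le_mul ?_ h1 (norm_nonneg _) (by positivity))
      refine (norm_mul_le _ _).trans (mul_le_mul_of_nonneg_right ?_ (norm_nonneg _))
      exact (norm_pow_mul_le hK hr₀K _ _).trans (by gcongr)
    exact h.trans_eq (by ring)

theorem continuousOn_inverse_smul_one_sub {S : E →L[ℂ] E} {γ : ℝ → ℂ} {s : Set ℝ}
    (hγ : ContinuousOn γ s) (hs : ∀ t ∈ s, γ t ∉ spectrum ℂ S) :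
    ContinuousOn (fun t => Ring.inverse (γ t • (1 : E →L[ℂ] E) - S)) s := by
  intro t ht
  obtain ⟨u, hu⟩ := isUnit_smul_one_sub (hs t ht)
  have h := NormedRing.inverse_continuousAt u
  rw [hu] at h
  exact h.comp_continuousWithinAt (f := fun t => γ t • (1 : E →L[ℂ] E) - S)
    (((hγ t ht).smul continuousWithinAt_const).sub continuousWithinAt_const)

theorem inverse_smul_one_sub_eq {S : E →L[ℂ] E} {z w : ℂ} (hz : z ∉ spectrum ℂ S)
    (hw : w ∉ spectrum ℂ S) :
    Ring.inverse (z • (1 : E →L[ℂ] E) - S) = Ring.inverse (w • (1 : E →L[ℂ] E) - S) +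
      (w - z) • (Ring.inverse (w • (1 : E →L[ℂ] E) - S) *
        Ring.inverse (z • (1 : E →L[ℂ] E) - S)) := by
  have hw' := Ring.inverse_mul_cancel _ (isUnit_smul_one_sub hw)
  have hz' := Ring.mul_inverse_cancel _ (isUnit_smul_one_sub hz)
  set P := Ring.inverse (z • (1 : E →L[ℂ] E) - S)
  set Q := Ring.inverse (w • (1 : E →L[ℂ] E) - S)
  calc P = Q * (w • 1 - S) * P := by rw [hw', one_mul]
    _ = Q * ((z • 1 - S) * P) + (w - z) • (Q * P) := by
      rw [show w • (1 : E →L[ℂ] E) - S = (z • 1 - S) + (w - z) • 1 by rw [sub_smul]; abel]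
      rw [mul_add, add_mul, mul_smul_comm, mul_one, smul_mul_assoc, mul_assoc]
    _ = _ := by rw [hz', mul_one]

theorem inverse_smul_one_sub_commutator {S : E →L[ℂ] E} (T : E →L[ℂ] E) {z : ℂ}
    (hz : z ∉ spectrum ℂ S) :
    Ring.inverse (z • (1 : E →L[ℂ] E) - S) * T - T * Ring.inverse (z • (1 : E →L[ℂ] E) - S) =
      Ring.inverse (z • (1 : E →L[ℂ] E) - S) * (S * T - T * S) *
        Ring.inverse (z • (1 : E →L[ℂ] E) - S) := by
  have h1 := Ring.inverse_mul_cancel _ (isUnit_smul_one_sub hz)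
  have h2 := Ring.mul_inverse_cancel _ (isUnit_smul_one_sub hz)
  set P := Ring.inverse (z • (1 : E →L[ℂ] E) - S)
  have h3 : S * T - T * S = T * (z • 1 - S) - (z • 1 - S) * T := by
    simp only [mul_sub, sub_mul, mul_smul_comm, smul_mul_assoc, mul_one, one_mul]
    abel
  rw [h3, mul_sub, sub_mul, ← mul_assoc P (z • 1 - S) T, h1, one_mul, mul_assoc P,
    mul_assoc T, h2, mul_one]

/-- The integral of `z ↦ c • (z - S)⁻¹ * A * (z - S)⁻¹` along a curve in the resolvent set of `S`
is in `L^p` whenever `A` is. -/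
theorem MemSchatten.integral_resolvent_mul_mul (hp0 : 0 < p) (hp1 : p ≤ 1) {A S : E →L[ℂ] E}
    (hA : MemSchatten p A) {c γ : ℝ → ℂ} (hc : ContinuousOn c (Set.Icc 0 1))
    (hγ : ContinuousOn γ (Set.Icc 0 1)) (hγS : ∀ t ∈ Set.Icc (0 : ℝ) 1, γ t ∉ spectrum ℂ S) :
    MemSchatten p (∫ t in (0 : ℝ)..1, c t • (Ring.inverse (γ t • (1 : E →L[ℂ] E) - S) * A *
      Ring.inverse (γ t • (1 : E →L[ℂ] E) - S))) := by
  set r : ℝ → E →L[ℂ] E := fun t => Ring.inverse (γ t • (1 : E →L[ℂ] E) - S) with hr_def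
  have hr : ContinuousOn r (Set.Icc 0 1) := continuousOn_inverse_smul_one_sub hγ hγS
  obtain ⟨K₀, hK₀⟩ := isCompact_Icc.exists_bound_of_continuousOn hr
  obtain ⟨L, hL⟩ := isCompact_Icc.exists_bound_of_continuousOn hc
  obtain ⟨K, hK, hKpos⟩ : ∃ K, (∀ t ∈ Set.Icc (0 : ℝ) 1, ‖r t‖ ≤ K) ∧ 0 < K :=
    ⟨max K₀ 1, fun t ht => (hK₀ t ht).trans (le_max_left _ _), by positivity⟩
  set δ : ℝ := (1 / 4) ^ p⁻¹ with hδ_def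
  have hδpos : 0 < δ := by positivity
  have hδ : 2 * δ ^ p < 1 := by
    rw [hδ_def, Real.rpow_inv_rpow (by norm_num) hp0.ne']
    norm_num
  obtain ⟨η, hη, hγη⟩ := Metric.uniformContinuousOn_iff.1
    (isCompact_Icc.uniformContinuousOn_of_continuous hγ) (δ / K) (by positivity)
  obtain ⟨N, hN⟩ := exists_nat_one_div_lt hη
  set a : ℕ → ℝ := fun i => i / (N + 1 : ℕ) with ha_def
  have hN0 : (0 : ℝ) < (N + 1 : ℕ) := by positivity
  have ha_step : ∀ i, a (i + 1) = a i + 1 / (N + 1 : ℕ) := fun i => by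
    simp only [ha_def]; push_cast; ring
  have ha_le : ∀ i, a i ≤ a (i + 1) := fun i => by
    rw [ha_step]; exact le_add_of_nonneg_right (by positivity)
  have ha_sub : ∀ i < N + 1, Set.Icc (a i) (a (i + 1)) ⊆ Set.Icc 0 1 := fun i hi =>
    Set.Icc_subset_Icc (by positivity) ((div_le_one hN0).2 (by exact_mod_cast hi))
  have hcont : ContinuousOn (fun t => c t • (r t * A * r t)) (Set.Icc 0 1) := by fun_prop
  have hsplit := intervalIntegral.sum_integral_adjacent_intervals (a := a) (n := N + 1)
    (μ := volume) fun i hi => (hcont.mono (ha_sub i hi)).intervalIntegrable_of_Icc (ha_le i)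
  have ha0 : a 0 = 0 := by simp [ha_def]
  have haN : a (N + 1) = 1 := div_self hN0.ne'
  rw [ha0, haN] at hsplit
  rw [← hsplit]
  refine MemSchatten.sum hp0 hp1 _ fun i hi => ?_
  have hsub := ha_sub i (Finset.mem_range.1 hi)
  have hai : a i ∈ Set.Icc (0 : ℝ) 1 := hsub (Set.left_mem_Icc.2 (ha_le i))
  refine hA.integral_of_resolvent_identity hp0 hp1 (ha_le i) (r₀ := r (a i))
    (ζ := fun t => γ (a i) - γ t) (K := K) (L := L) (ρ := δ / K) (hr.mono hsub) (hc.mono hsub)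
    (continuousOn_const.sub (hγ.mono hsub))
    (fun t ht => inverse_smul_one_sub_eq (hγS t (hsub ht)) (hγS _ hai)) (hK _ hai)
    (fun t ht => hK t (hsub ht)) (fun t ht => hL t (hsub ht)) (fun t ht => ?_)
    (by rwa [mul_div_cancel₀ _ hKpos.ne'])
  rw [← dist_eq_norm]
  refine (hγη _ hai t (hsub ht) ?_).le
  rw [dist_comm, Real.dist_eq, abs_of_nonneg (sub_nonneg.2 ht.1)]
  have h := ht.2
  rw [ha_step] at h
  push_cast at h
  linarith

end ResolventIntegral

/-- Let `p ∈ (0,1)` and `S, T ∈ B(H)` with `[S,T] ∈ L^p(H)`. Then for every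
function `f` holomorphic on an open neighbourhood of `σ(S)`, the commutator `[f(S), T]`
lies in `L^p(H)`, where `f(S)` is the Riesz–Dunford holomorphic functional calculus. -/
theorem commutator_holomorphicFunctionalCalculus_mem_schatten
    (p : ℝ) (hp0 : 0 < p) (hp1 : p < 1)
    (S T : H →L[ℂ] H) (hST : MemSchatten p (S * T - T * S))
    (U : Set ℂ) (hU : IsOpen U) (hσ : spectrum ℂ S ⊆ U)
    (f : ℂ → ℂ) (hf : DifferentiableOn ℂ f U)
    (mΓ : ℕ) (γ : Fin mΓ → ℝ → ℂ)
    (hγ_smooth : ∀ k, ContDiff ℝ 1 (γ k))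
    (hγ_closed : ∀ k, γ k 1 = γ k 0)
    (hγ_range : ∀ k, ∀ t ∈ Set.Icc (0:ℝ) 1, γ k t ∈ U \ spectrum ℂ S)
    (hγ_wind_one : ∀ w ∈ spectrum ℂ S,
      contourIntC mΓ γ (fun z => (z - w)⁻¹) = 2 * Real.pi * Complex.I)
    (hγ_wind_zero : ∀ w : ℂ, w ∉ U → contourIntC mΓ γ (fun z => (z - w)⁻¹) = 0) :
    MemSchatten p (dunfordIntegral mΓ γ S f * T - T * dunfordIntegral mΓ γ S f) := by
  have hint : ∀ {g : ℝ → H →L[ℂ] H}, ContinuousOn g (Set.Icc 0 1) →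
      IntervalIntegrable g volume 0 1 := fun hg => hg.intervalIntegrable_of_Icc zero_le_one
  have hγ : ∀ k, ContinuousOn (γ k) (Set.Icc 0 1) := fun k => (hγ_smooth k).continuous.continuousOn
  have hc : ∀ k, ContinuousOn (fun t => f (γ k t) * deriv (γ k) t) (Set.Icc 0 1) := fun k =>
    (hf.continuousOn.comp (hγ k) fun t ht => (hγ_range k t ht).1).mul
      ((hγ_smooth k).continuous_deriv le_rfl).continuousOn
  have hr : ∀ k, ContinuousOn (fun t => (f (γ k t) * deriv (γ k) t) •
      Ring.inverse (γ k t • (1 : H →L[ℂ] H) - S)) (Set.Icc 0 1) := fun k =>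
    (hc k).smul (continuousOn_inverse_smul_one_sub (hγ k) fun t ht => (hγ_range k t ht).2)
  rw [dunfordIntegral, smul_mul_assoc, mul_smul_comm, ← smul_sub, Finset.sum_mul, Finset.mul_sum,
    ← Finset.sum_sub_distrib]
  refine (MemSchatten.sum hp0 hp1.le _ fun k _ => ?_).smul hp0 _
  have hcomm : ∀ X : H →L[ℂ] H, X * T - T * X =
      ((ContinuousLinearMap.mul ℂ (H →L[ℂ] H)).flip T - ContinuousLinearMap.mul ℂ (H →L[ℂ] H) T) X :=
    fun X => by simp
  rw [hcomm, ← ContinuousLinearMap.intervalIntegral_comp_comm _ (hint (hr k)),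
    intervalIntegral.integral_congr (g := fun t => (f (γ k t) * deriv (γ k) t) •
      (Ring.inverse (γ k t • (1 : H →L[ℂ] H) - S) * (S * T - T * S) *
        Ring.inverse (γ k t • (1 : H →L[ℂ] H) - S)))]
  · exact hST.integral_resolvent_mul_mul hp0 hp1.le (hc k) (hγ k) fun t ht => (hγ_range k t ht).2
  · intro t ht
    rw [Set.uIcc_of_le zero_le_one] at ht
    dsimp only
    rw [← hcomm, smul_mul_assoc, mul_smul_comm, ← smul_sub,
      inverse_smul_one_sub_commutator T (hγ_range k t ht).2]
end

section
/- Let H be a Hilbert space, I ⊆ B(H) a two-sided ideal, A and B C*-subalgebras of B(H), and 𝒜 ⊆ A, ℬ ⊆ B dense *-subalgebras such that [a,b] ∈ I for all a ∈ 𝒜 and b ∈ ℬ. Define 𝒜_ℬ = {a ∈ A : [a,b] ∈ I for all b ∈ ℬ} and ℬ_𝒜 = {b ∈ B : [a,b] ∈ I for all a ∈ 𝒜_ℬ}. Then: (1) 𝒜 ⊆ 𝒜_ℬ and ℬ ⊆ ℬ_𝒜; (2) 𝒜_ℬ and ℬ_𝒜 are dense *-subalgebras of A and B respectively; (3) [a,b]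 ∈ I for all a ∈ 𝒜_ℬ and b ∈ ℬ_𝒜; (4) 𝒜_ℬ is inverse closed: if a ∈ 𝒜_ℬ, μ ∈ ℂ with μ ≠ 0, and μ·1 + a is invertible in B(H) with (μ·1 + a)^{-1} = μ^{-1}·1 + a' for some a' ∈ A, then a' ∈ 𝒜_ℬ; and likewise ℬ_𝒜 is inverse closed. -/
namespace ContinuousLinearMap

variable {H : Type*} [NormedAddCommGroup H] [InnerProductSpace ℂ H]

/-- Douglas' factorization lemma: an operator that is dominated in norm by `T` pointwise factors
through `T` on the left. -/
theorem exists_mul_eq_of_norm_apply_le [CompleteSpace H] {S T : H →L[ℂ] H}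
    (h : ∀ x, ‖S x‖ ≤ ‖T x‖) : ∃ C : H →L[ℂ] H, C * T = S := by
  let K : Submodule ℂ H := T.range.topologicalClosure
  have : CompleteSpace K := T.range.isClosed_topologicalClosure.completeSpace_coe
  have hK : ∀ x, T x ∈ K := fun x => T.range.le_topologicalClosure ⟨x, rfl⟩
  let e : H →ₗ[ℂ] K := (T : H →ₗ[ℂ] H).codRestrict K hK
  have hdense : DenseRange e := by
    rintro ⟨y, hy⟩
    rw [closure_subtype]
    refine closure_mono ?_ hy
    rintro _ ⟨x, rfl⟩
    exact ⟨e x, ⟨x, rfl⟩, rfl⟩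
  refine ⟨((S : H →ₗ[ℂ] H).extendOfNorm e).comp K.orthogonalProjectionOnto, ?_⟩
  ext x
  have hproj : K.orthogonalProjectionOnto (T x) = e x :=
    K.orthogonalProjectionOnto_mem_subspace_eq_self (e x)
  change (S : H →ₗ[ℂ] H).extendOfNorm e (K.orthogonalProjectionOnto (T x)) = S x
  rw [hproj]
  exact LinearMap.extendOfNorm_eq hdense ⟨1, fun y => by simpa using! h y⟩ x

theorem norm_cfcAbs_apply [CompleteSpace H] (T : H →L[ℂ] H) (x : H) :
    ‖CFC.abs T x‖ = ‖T x‖ := by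
  have hsa : star (CFC.abs T) = CFC.abs T := (CFC.abs_nonneg T).isSelfAdjoint
  have hinner : inner ℂ (CFC.abs T x) (CFC.abs T x) = inner ℂ (T x) (T x) := by
    rw [← adjoint_inner_right, ← adjoint_inner_right T, ← star_eq_adjoint, ← star_eq_adjoint, hsa]
    exact congrArg (fun S : H →L[ℂ] H => inner ℂ x (S x)) (CFC.abs_mul_abs T)
  rw [inner_self_eq_norm_sq_to_K, inner_self_eq_norm_sq_to_K] at hinner
  exact (sq_eq_sq₀ (norm_nonneg _) (norm_nonneg _)).mp (by exact_mod_cast hinner)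

end ContinuousLinearMap

/-- Every two-sided ideal of `B(H)` is self-adjoint. -/
theorem TwoSidedIdeal.star_mem_of_continuousLinearMap
    {H : Type*} [NormedAddCommGroup H] [InnerProductSpace ℂ H] [CompleteSpace H]
    (J : TwoSidedIdeal (H →L[ℂ] H)) {T : H →L[ℂ] H} (hT : T ∈ J) : star T ∈ J := by
  obtain ⟨V, hV⟩ := ContinuousLinearMap.exists_mul_eq_of_norm_apply_le
    fun x => (T.norm_cfcAbs_apply x).le
  obtain ⟨U, hU⟩ := ContinuousLinearMap.exists_mul_eq_of_norm_apply_le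
    fun x => (T.norm_cfcAbs_apply x).ge
  have hstar : star T = V * T * star U := by
    rw [hV, ← (CFC.abs_nonneg T).isSelfAdjoint.star_eq, ← star_mul, hU]
  rw [hstar]
  exact J.mul_mem_right _ _ (J.mul_mem_left _ _ hT)

namespace TwoSidedIdeal

variable {R : Type*} [Ring R] (J : TwoSidedIdeal R)

theorem commutator_mem_comm {x y : R} : x * y - y * x ∈ J ↔ y * x - x * y ∈ J := by
  constructor <;> intro h <;> simpa using J.neg_mem h

variable {J}

theorem add_commutator_mem {x y z : R} (hx : x * z - z * x ∈ J) (hy : y * z - z * y ∈ J) :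
    (x + y) * z - z * (x + y) ∈ J := by
  convert J.add_mem hx hy using 1
  noncomm_ring

theorem mul_commutator_mem {x y z : R} (hx : x * z - z * x ∈ J) (hy : y * z - z * y ∈ J) :
    (x * y) * z - z * (x * y) ∈ J := by
  convert J.add_mem (J.mul_mem_left x _ hy) (J.mul_mem_right _ y hx) using 1
  noncomm_ring

theorem smul_commutator_mem {k : Type*} [CommRing k] [Algebra k R] {x z : R} (c : k)
    (hx : x * z - z * x ∈ J) : (c • x) * z - z * (c • x) ∈ J := by
  convert J.mul_mem_left (algebraMap k R c) _ hx using 1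
  rw [← Algebra.smul_def, smul_sub, smul_mul_assoc, mul_smul_comm]

theorem star_commutator_mem [StarRing R] (hJ : ∀ r ∈ J, star r ∈ J) {x z : R}
    (hx : x * star z - star z * x ∈ J) : star x * z - z * star x ∈ J := by
  rw [commutator_mem_comm]
  simpa using hJ _ hx

/-- If `u` commutes with `z` modulo `J`, then so does its inverse `v`; here `u` and `v` are given
up to the central scalars `c` and `d`. -/
theorem inverse_commutator_mem {k : Type*} [CommRing k] [Algebra k R] {x y z : R} {c d : k}
    (hx : x * z - z * x ∈ J) (hxy : (c • (1 : R) + x) * (d • (1 : R) + y) = 1)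
    (hyx : (d • (1 : R) + y) * (c • (1 : R) + x) = 1) : y * z - z * y ∈ J := by
  have key : ∀ (e : k) (w : R), (e • (1 : R) + w) * z - z * (e • (1 : R) + w) = w * z - z * w := by
    intro e w
    simp [add_mul, mul_add]
  rw [← key c] at hx
  rw [← key d]
  set u := c • (1 : R) + x
  set v := d • (1 : R) + y
  convert J.mul_mem_right _ v (J.mul_mem_left v _ (J.commutator_mem_comm.mp hx)) using 1
  calc v * z - z * v = v * z * (u * v) - (v * u) * z * v := by rw [hxy, hyx, mul_one, one_mul]
    _ = v * (z * u - u * z) * v := by noncomm_ring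

end TwoSidedIdeal

/-- Let `I ⊆ B(H)` be a two-sided ideal, `A, B` C*-subalgebras of `B(H)`,
and `𝒜 ⊆ A`, `ℬ ⊆ B` dense *-subalgebras with `[𝒜, ℬ] ⊆ I`.  With
`𝒜_ℬ = {a ∈ A : [a,b] ∈ I ∀ b ∈ ℬ}` and `ℬ_𝒜 = {b ∈ B : [a,b] ∈ I ∀ a ∈ 𝒜_ℬ}`:
(1) `𝒜 ⊆ 𝒜_ℬ`, `ℬ ⊆ ℬ_𝒜`; (2) both are dense *-subalgebras of `A` resp. `B`;
(3) `[𝒜_ℬ, ℬ_𝒜] ⊆ I`; (4) both are inverse closed. -/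
theorem almost_commuting_dense_subalgebras_enlarge
    {H : Type*} [NormedAddCommGroup H] [InnerProductSpace ℂ H] [CompleteSpace H]
    (I : Set (H →L[ℂ] H))
    (hI_zero : (0 : H →L[ℂ] H) ∈ I)
    (hI_add : ∀ R ∈ I, ∀ R' ∈ I, R + R' ∈ I)
    (hI_mulL : ∀ A : H →L[ℂ] H, ∀ R ∈ I, A * R ∈ I)
    (hI_mulR : ∀ A : H →L[ℂ] H, ∀ R ∈ I, R * A ∈ I)
    (A B : NonUnitalStarSubalgebra ℂ (H →L[ℂ] H))
    (hA_closed : IsClosed (A : Set (H →L[ℂ] H)))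
    (hB_closed : IsClosed (B : Set (H →L[ℂ] H)))
    (𝒜 ℬ : NonUnitalStarSubalgebra ℂ (H →L[ℂ] H))
    (h𝒜A : (𝒜 : Set (H →L[ℂ] H)) ⊆ A) (hℬB : (ℬ : Set (H →L[ℂ] H)) ⊆ B)
    (h𝒜dense : (A : Set (H →L[ℂ] H)) ⊆ closure (𝒜 : Set (H →L[ℂ] H)))
    (hℬdense : (B : Set (H →L[ℂ] H)) ⊆ closure (ℬ : Set (H →L[ℂ] H)))
    (hcomm : ∀ a ∈ 𝒜, ∀ b ∈ ℬ, a * b - b * a ∈ I) :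
    let AB : Set (H →L[ℂ] H) := {a | a ∈ A ∧ ∀ b ∈ ℬ, a * b - b * a ∈ I}
    let BA : Set (H →L[ℂ] H) := {b | b ∈ B ∧ ∀ a ∈ AB, a * b - b * a ∈ I}
    -- (1) they contain 𝒜 and ℬ
    ((𝒜 : Set (H →L[ℂ] H)) ⊆ AB ∧ (ℬ : Set (H →L[ℂ] H)) ⊆ BA) ∧
    -- (2) they are dense *-subalgebras of A and B
    ((∀ x ∈ AB, ∀ y ∈ AB, x + y ∈ AB ∧ x * y ∈ AB) ∧
      (∀ x ∈ AB, star x ∈ AB ∧ ∀ c : ℂ, c • x ∈ AB) ∧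
      AB ⊆ (A : Set (H →L[ℂ] H)) ∧ (A : Set (H →L[ℂ] H)) ⊆ closure AB ∧
      (∀ x ∈ BA, ∀ y ∈ BA, x + y ∈ BA ∧ x * y ∈ BA) ∧
      (∀ x ∈ BA, star x ∈ BA ∧ ∀ c : ℂ, c • x ∈ BA) ∧
      BA ⊆ (B : Set (H →L[ℂ] H)) ∧ (B : Set (H →L[ℂ] H)) ⊆ closure BA) ∧
    -- (3) they commute modulo I
    (∀ a ∈ AB, ∀ b ∈ BA, a * b - b * a ∈ I) ∧
    -- (4) they are inverse closed
    ((∀ a ∈ AB, ∀ μ : ℂ, μ ≠ 0 → ∀ a' ∈ A,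
        (μ • (1 : H →L[ℂ] H) + a) * (μ⁻¹ • (1 : H →L[ℂ] H) + a') = 1 →
        (μ⁻¹ • (1 : H →L[ℂ] H) + a') * (μ • (1 : H →L[ℂ] H) + a) = 1 →
        a' ∈ AB) ∧
      (∀ b ∈ BA, ∀ μ : ℂ, μ ≠ 0 → ∀ b' ∈ B,
        (μ • (1 : H →L[ℂ] H) + b) * (μ⁻¹ • (1 : H →L[ℂ] H) + b') = 1 →
        (μ⁻¹ • (1 : H →L[ℂ] H) + b') * (μ • (1 : H →L[ℂ] H) + b) = 1 →
        b' ∈ BA)) := by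
  intro AB BA
  obtain ⟨J, hJ⟩ : ∃ J : TwoSidedIdeal (H →L[ℂ] H), ∀ x, x ∈ I ↔ x ∈ J :=
    ⟨.mk' I hI_zero (fun hx hy => hI_add _ hx _ hy)
      (fun {x} hx => by simpa using hI_mulL (-1) x hx) (fun hy => hI_mulL _ _ hy)
      (fun hx => hI_mulR _ _ hx), fun x => (TwoSidedIdeal.mem_mk' ..).symm⟩
  have hJstar : ∀ r ∈ J, star r ∈ J := fun _ => J.star_mem_of_continuousLinearMap
  have mem_AB : ∀ {a}, a ∈ AB ↔ a ∈ A ∧ ∀ b ∈ ℬ, a * b - b * a ∈ J := by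
    simp only [AB, hJ, Set.mem_ofPred_eq, implies_true]
  have mem_BA : ∀ {b}, b ∈ BA ↔ b ∈ B ∧ ∀ a ∈ AB, b * a - a * b ∈ J := by
    intro b
    simp only [BA, hJ, Set.mem_ofPred_eq, J.commutator_mem_comm (x := b)]
  have star_AB : ∀ {x}, x ∈ AB → star x ∈ AB := fun {x} hx =>
    mem_AB.mpr ⟨star_mem (mem_AB.mp hx).1, fun b hb =>
      TwoSidedIdeal.star_commutator_mem hJstar ((mem_AB.mp hx).2 _ (star_mem hb))⟩
  have h𝒜AB : (𝒜 : Set (H →L[ℂ] H)) ⊆ AB := fun a ha => ⟨h𝒜A ha, hcomm a ha⟩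
  have hℬBA : (ℬ : Set (H →L[ℂ] H)) ⊆ BA := fun b hb => ⟨hℬB hb, fun a ha => ha.2 b hb⟩
  refine ⟨⟨h𝒜AB, hℬBA⟩, ⟨?_, ?_, fun _ h => h.1, h𝒜dense.trans (closure_mono h𝒜AB), ?_, ?_,
    fun _ h => h.1, hℬdense.trans (closure_mono hℬBA)⟩, fun a ha b hb => hb.2 a ha, ?_, ?_⟩
  · intro x hx y hy
    rw [mem_AB] at hx hy
    exact ⟨mem_AB.mpr ⟨add_mem hx.1 hy.1, fun b hb =>
        TwoSidedIdeal.add_commutator_mem (hx.2 b hb) (hy.2 b hb)⟩,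
      mem_AB.mpr ⟨mul_mem hx.1 hy.1, fun b hb =>
        TwoSidedIdeal.mul_commutator_mem (hx.2 b hb) (hy.2 b hb)⟩⟩
  · intro x hx
    refine ⟨star_AB hx, fun c => ?_⟩
    rw [mem_AB] at hx ⊢
    exact ⟨SMulMemClass.smul_mem c hx.1, fun b hb => TwoSidedIdeal.smul_commutator_mem c (hx.2 b hb)⟩
  · intro x hx y hy
    rw [mem_BA] at hx hy
    exact ⟨mem_BA.mpr ⟨add_mem hx.1 hy.1, fun a ha =>
        TwoSidedIdeal.add_commutator_mem (hx.2 a ha) (hy.2 a ha)⟩,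
      mem_BA.mpr ⟨mul_mem hx.1 hy.1, fun a ha =>
        TwoSidedIdeal.mul_commutator_mem (hx.2 a ha) (hy.2 a ha)⟩⟩
  · intro x hx
    rw [mem_BA] at hx
    exact ⟨mem_BA.mpr ⟨star_mem hx.1, fun a ha =>
        TwoSidedIdeal.star_commutator_mem hJstar (hx.2 _ (star_AB ha))⟩,
      fun c => mem_BA.mpr ⟨SMulMemClass.smul_mem c hx.1, fun a ha =>
        TwoSidedIdeal.smul_commutator_mem c (hx.2 a ha)⟩⟩
  · intro a ha μ _ a' ha' h₁ h₂
    exact mem_AB.mpr ⟨ha', fun b hb =>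
      TwoSidedIdeal.inverse_commutator_mem ((mem_AB.mp ha).2 b hb) h₁ h₂⟩
  · intro b hb μ _ b' hb' h₁ h₂
    exact mem_BA.mpr ⟨hb', fun a ha =>
      TwoSidedIdeal.inverse_commutator_mem ((mem_BA.mp hb).2 a ha) h₁ h₂⟩
end

section
/- Let H be a Hilbert space and (T_n)_{n∈ℕ} a sequence of positive operators in B(H) such that T_n ≤ T_{n+1} for all n, sup_n ‖T_n‖ < ∞, and T_{n+1}·T_n = T_n for all n. Then (T_n) converges in the strong operator topology to an orthogonal projection P ∈ B(H) (i.e. P = P* = P²), and P satisfies P·T_n = T_n = T_n·P for all n. -/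
/-- The operators of an increasing sequence that fix all earlier ranges satisfy `Tₘ Tₙ = Tₙ`
for `n < m`. -/
theorem mul_eq_right_of_lt_of_succ_mul {M : Type*} [Semigroup M] {T : ℕ → M}
    (hTT : ∀ n, T (n + 1) * T n = T n) {n m : ℕ} (hnm : n < m) : T m * T n = T n := by
  induction m, hnm using Nat.le_induction with
  | base => exact hTT n
  | succ m _ ih => rw [← ih, ← mul_assoc, hTT]

namespace ContinuousLinearMap

/-- If `T` and `S - T` are positive and `S T = T`, then `T² ≤ T`. -/
theorem IsPositive.norm_apply_sq_le_of_mul_eq_right {H : Type*} [NormedAddCommGroup H]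
    [InnerProductSpace ℂ H] [CompleteSpace H] {S T : H →L[ℂ] H} (hT : T.IsPositive)
    (hST : (S - T).IsPositive) (hmul : S * T = T) (ξ : H) :
    ‖T ξ‖ ^ 2 ≤ T.reApplyInnerSelf ξ := by
  have hS : IsSelfAdjoint S := by simpa using hST.isSelfAdjoint.add hT.isSelfAdjoint
  have hmul' : T * S = T := by
    simpa [hS.star_eq, hT.isSelfAdjoint.star_eq] using congrArg star hmul
  have hcomm : Commute T (S - T) := by
    simp [Commute, SemiconjBy, mul_sub, sub_mul, hmul, hmul']
  have hpos : (T * (S - T)).IsPositive :=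
    (nonneg_iff_isPositive _).1 <| hcomm.mul_nonneg
      ((nonneg_iff_isPositive _).2 hT) ((nonneg_iff_isPositive _).2 hST)
  rw [mul_sub, hmul'] at hpos
  have h := hpos.re_inner_nonneg_left ξ
  rw [sub_apply, inner_sub_left, map_sub, mul_apply_eq_comp,
    hT.inner_left_eq_inner_right (T ξ) ξ, inner_self_eq_norm_sq] at h
  exact sub_nonneg.1 h

end ContinuousLinearMap

/-- An increasing, uniformly bounded sequence of positive operators `Tₙ`
on a Hilbert space with `Tₙ₊₁·Tₙ = Tₙ` converges strongly to an orthogonal projection `P`,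
and `P·Tₙ = Tₙ = Tₙ·P` for all `n`. -/
theorem increasing_positive_operators_tendsto_projection
    {H : Type*} [NormedAddCommGroup H] [InnerProductSpace ℂ H] [CompleteSpace H]
    (T : ℕ → H →L[ℂ] H)
    (hpos : ∀ n, (T n).IsPositive)
    (hmono : ∀ n, (T (n + 1) - T n).IsPositive)
    (hbdd : ∃ C : ℝ, ∀ n, ‖T n‖ ≤ C)
    (hTT : ∀ n, T (n + 1) * T n = T n) :
    ∃ P : H →L[ℂ] H,
      (∀ ξ : H, Filter.Tendsto (fun n => T n ξ) Filter.atTop (nhds (P ξ))) ∧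
      IsSelfAdjoint P ∧ P * P = P ∧
      ∀ n, P * T n = T n ∧ T n * P = T n := by
  obtain ⟨C, hC⟩ := hbdd
  have hlt {n m : ℕ} (h : n < m) : T m * T n = T n := mul_eq_right_of_lt_of_succ_mul hTT h
  have hlt' {n m : ℕ} (h : n < m) : T n * T m = T n := by
    simpa [(hpos _).isSelfAdjoint.star_eq] using congrArg star (hlt h)
  have hsq (n : ℕ) (ξ : H) : ‖T n ξ‖ ^ 2 ≤ (T n).reApplyInnerSelf ξ :=
    (hpos n).norm_apply_sq_le_of_mul_eq_right (hmono n) (hTT n) ξ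
  have hdiff {n m : ℕ} (h : n < m) (ξ : H) :
      ‖T m ξ - T n ξ‖ ^ 2 ≤ (T m).reApplyInnerSelf ξ - (T n).reApplyInnerSelf ξ := by
    have hinner : RCLike.re (inner ℂ (T m ξ) (T n ξ)) = (T n).reApplyInnerSelf ξ := by
      rw [(hpos m).inner_left_eq_inner_right, ← mul_apply_eq_comp, hlt h,
        ← (hpos n).inner_left_eq_inner_right, ContinuousLinearMap.reApplyInnerSelf_apply]
    rw [@norm_sub_sq ℂ, hinner]
    linarith [hsq n ξ, hsq m ξ]
  have hform (ξ : H) : CauchySeq fun n => (T n).reApplyInnerSelf ξ := by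
    refine (tendsto_atTop_ciSup (monotone_nat_of_le_succ fun n => ?_)
      ⟨C * ‖ξ‖ * ‖ξ‖, ?_⟩).cauchySeq
    · exact sub_nonneg.1 ((sq_nonneg _).trans (hdiff n.lt_succ_self ξ))
    · rintro _ ⟨n, rfl⟩
      exact (re_inner_le_norm _ _).trans <|
        mul_le_mul_of_nonneg_right ((T n).le_of_opNorm_le (hC n) ξ) (norm_nonneg ξ)
  have hcauchy (ξ : H) : CauchySeq fun n => T n ξ := by
    refine Metric.cauchySeq_iff'.2 fun ε hε => ?_
    obtain ⟨N, hN⟩ := Metric.cauchySeq_iff'.1 (hform ξ) (ε ^ 2) (by positivity)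
    refine ⟨N, fun n hn => ?_⟩
    rcases hn.eq_or_lt with rfl | hn'
    · simpa using hε
    · rw [dist_eq_norm]
      refine lt_of_pow_lt_pow_left₀ 2 hε.le ((hdiff hn' ξ).trans_lt ?_)
      exact (le_abs_self _).trans_lt (hN n hn)
  choose f hf using fun ξ => cauchySeq_tendsto_of_complete (hcauchy ξ)
  let P : H →L[ℂ] H := continuousLinearMapOfTendsto T (tendsto_pi_nhds.2 hf)
  have hP (ξ : H) : Filter.Tendsto (fun n => T n ξ) Filter.atTop (nhds (P ξ)) := hf ξ
  have hTP (n : ℕ) : T n * P = T n := by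
    ext ξ
    refine tendsto_nhds_unique (((T n).continuous.tendsto _).comp (hP ξ))
      (tendsto_const_nhds.congr' ?_)
    filter_upwards [Filter.eventually_gt_atTop n] with m hm
    exact (DFunLike.congr_fun (hlt' hm) ξ).symm
  refine ⟨P, hP, ?_, ?_, fun n => ⟨?_, hTP n⟩⟩
  · rw [ContinuousLinearMap.isSelfAdjoint_iff_isSymmetric]
    intro ξ η
    refine tendsto_nhds_unique ((hP ξ).inner tendsto_const_nhds) ?_
    simp_rw [(hpos _).inner_left_eq_inner_right]
    exact tendsto_const_nhds.inner (hP η)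
  · ext ξ
    refine tendsto_nhds_unique (hP (P ξ)) ((hP ξ).congr fun n => ?_)
    exact (DFunLike.congr_fun (hTP n) ξ).symm
  · ext ξ
    refine tendsto_nhds_unique (hP (T n ξ)) (tendsto_const_nhds.congr' ?_)
    filter_upwards [Filter.eventually_gt_atTop n] with m hm
    exact (DFunLike.congr_fun (hlt hm) ξ).symm
end

section
/- Let (Σ_M, σ) be a topological Markov chain with ultrametric d_λ, λ > 1. Let c₁, c₂ ∈ Σ_M, let N ≥ 0 be an integer with σ^N(c₂) ∈ X^s(σ^N(c₁), λ^{−1}), and let 0 < η ≤ λ^{−N−1}. Then the stable holonomy map h^s(z) = σ^{−N}[σ^N(z), σ^N(c₁)] is well defined for every z ∈ X^u(c₂, η) (the bracket [σ^N(z), σ^N(c₁)] is defined and lies in Σ_M), h^s maps X^u(c₂, η) into X^u(c₁, η), and h^s is an isometry: d_λ(h^s(z), h^s(w)) = d_λ(z, w) for all z, w ∈ X^u(c₂, η). -/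
open scoped Classical

/-- A sequence `x : ℤ → Fin m` is allowable for the 0-1 matrix `M` if all its
transitions are allowed. -/
def IsMarkov {m : ℕ} (M : Fin m → Fin m → Bool) (x : ℤ → Fin m) : Prop :=
  ∀ i : ℤ, M (x i) (x (i + 1)) = true

/-- The topological Markov chain `Σ_M` of allowable bi-infinite sequences. -/
def TMC {m : ℕ} (M : Fin m → Fin m → Bool) : Type := {x : ℤ → Fin m // IsMarkov M x}

namespace TMC

variable {m : ℕ} {M : Fin m → Fin m → Bool}

instance : TopologicalSpace (TMC M) :=
  inferInstanceAs (TopologicalSpace {x : ℤ → Fin m // IsMarkov M x})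

/-- The shift homeomorphism `σ(x)_i = x_{i+1}`. -/
def shift (M : Fin m → Fin m → Bool) (x : TMC M) : TMC M :=
  ⟨fun i => x.1 (i + 1), fun i => x.2 (i + 1)⟩

/-- The inverse shift `σ⁻¹(x)_i = x_{i-1}`. -/
def shiftInv (M : Fin m → Fin m → Bool) (x : TMC M) : TMC M :=
  ⟨fun i => x.1 (i - 1), fun i => by
    have h : i + 1 - 1 = i - 1 + 1 := by ring
    show M (x.1 (i - 1)) (x.1 (i + 1 - 1)) = true
    rw [h]
    exact x.2 (i - 1)⟩

/-- The ultrametric `d_λ(x,y) = inf{λ^{-n} : n ≥ 0, xᵢ = yᵢ for |i| < n}`. -/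
noncomputable def dlam (lam : ℝ) (x y : TMC M) : ℝ :=
  sInf {r : ℝ | ∃ n : ℕ, (∀ i : ℤ, |i| < (n : ℤ) → x.1 i = y.1 i) ∧ r = lam ^ (-(n : ℤ))}

/-- The bracket (splicing) map: `[x,y]_n = y_n` for `n ≤ 0` and `[x,y]_n = x_n` for
`n ≥ 1`, defined when `x₀ = y₀` (junk value `x` otherwise). -/
noncomputable def bracket (x y : TMC M) : TMC M :=
  if h : x.1 0 = y.1 0 then
    ⟨fun n => if n ≤ 0 then y.1 n else x.1 n, by
      intro i
      by_cases h1 : i + 1 ≤ 0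
      · have h2 : i ≤ 0 := by omega
        simp only [if_pos h1, if_pos h2]
        exact y.2 i
      · by_cases h2 : i ≤ 0
        · have h3 : i = 0 := by omega
          subst h3
          simp only [if_neg h1, le_refl, if_pos]
          rw [← h]
          exact x.2 0
        · simp only [if_neg h1, if_neg h2]
          exact x.2 i⟩
  else x

/-- The local stable set `X^s(x,ε) = {y : d_λ(x,y) < ε, [x,y] = y}`. -/
def locStable (lam : ℝ) (x : TMC M) (ε : ℝ) : Set (TMC M) :=
  {y | dlam lam x y < ε ∧ bracket x y = y}

/-- The local unstable set `X^u(x,ε) = {y : d_λ(x,y) < ε, [y,x] = y}`. -/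
def locUnstable (lam : ℝ) (x : TMC M) (ε : ℝ) : Set (TMC M) :=
  {y | dlam lam x y < ε ∧ bracket y x = y}

/-- The global stable set `X^s(x) = {y : d_λ(σⁿx, σⁿy) → 0 as n → +∞}`. -/
def globStable (lam : ℝ) (x : TMC M) : Set (TMC M) :=
  {y | Filter.Tendsto (fun n : ℕ => dlam lam ((shift M)^[n] x) ((shift M)^[n] y))
        Filter.atTop (nhds 0)}

/-- The global unstable set `X^u(x) = {y : d_λ(σⁿx, σⁿy) → 0 as n → −∞}`. -/
def globUnstable (lam : ℝ) (x : TMC M) : Set (TMC M) :=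
  {y | Filter.Tendsto (fun n : ℕ => dlam lam ((shiftInv M)^[n] x) ((shiftInv M)^[n] y))
        Filter.atTop (nhds 0)}

/-- The (forward) `σ`-orbit of a point. -/
def orbit (q : TMC M) : Set (TMC M) := {y | ∃ k : ℕ, (shift M)^[k] q = y}

/-- `X^u(Q) = ∪_{q' ∈ Q} X^u(q')` for `Q` the orbit of `q`. -/
def XuQ (lam : ℝ) (q : TMC M) : Set (TMC M) := ⋃ q' ∈ orbit q, globUnstable lam q'

/-- The stable groupoid `G^s(Q) = {(x,y) : x,y ∈ X^u(Q), y ∈ X^s(x)}`. -/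
def GsQ (lam : ℝ) (q : TMC M) : Set (TMC M × TMC M) :=
  {a | a.1 ∈ XuQ lam q ∧ a.2 ∈ XuQ lam q ∧ a.2 ∈ globStable lam a.1}

/-- `c_s(a)`: the least `N ≥ 0` with `σ^N(a₂) ∈ X^s(σ^N(a₁), λ⁻¹)`. -/
noncomputable def cs (lam : ℝ) (a : TMC M × TMC M) : ℕ :=
  sInf {N : ℕ | (shift M)^[N] a.2 ∈ locStable lam ((shift M)^[N] a.1) lam⁻¹}

/-- The stable holonomy map `h^s(z) = σ^{-N}[σ^N(z), σ^N(c₁)]`. -/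
noncomputable def holS (N : ℕ) (c₁ z : TMC M) : TMC M :=
  (shiftInv M)^[N] (bracket ((shift M)^[N] z) ((shift M)^[N] c₁))

/-- The base set `V^s(c, η, N) = {(h^s(z), z) : z ∈ X^u(c₂, η)}`. -/
def Vs (lam : ℝ) (c : TMC M × TMC M) (η : ℝ) (N : ℕ) : Set (TMC M × TMC M) :=
  {b | b.2 ∈ locUnstable lam c.2 η ∧ b.1 = holS N c.1 b.2}

/-- `d_{s,λ}` on the stable groupoid. -/
noncomputable def dsl (lam : ℝ) (a b : TMC M × TMC M) : ℝ :=
  if b.2 ∈ locUnstable lam a.2 lam⁻¹ ∧ b.1 ∈ locUnstable lam a.1 lam⁻¹ then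
    max (dlam lam a.1 b.1) (dlam lam a.2 b.2)
  else 1

/-- The groupoid ultrametric `D_{s,λ}`. -/
noncomputable def Dsl (lam : ℝ) (a b : TMC M × TMC M) : ℝ :=
  if cs lam a = cs lam b then dsl lam a b else 1

/-- The induced metric `D̃_{s,λ}` on the unit space `X^u(Q)`. -/
noncomputable def DslUnits (lam : ℝ) (x y : TMC M) : ℝ :=
  if y ∈ locUnstable lam x lam⁻¹ then dlam lam x y else 1

end TMC

namespace TMC

variable {m : ℕ} {M : Fin m → Fin m → Bool}

theorem ext_val {x y : TMC M} (h : ∀ i, x.1 i = y.1 i) : x = y :=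
  Subtype.ext (funext h)

theorem iterate_shift_apply (N : ℕ) (x : TMC M) (i : ℤ) :
    ((shift M)^[N] x).1 i = x.1 (i + N) := by
  induction N generalizing x with
  | zero => simp
  | succ k ih =>
    rw [Function.iterate_succ_apply, ih]
    exact congrArg x.1 (show i + k + 1 = i + (k + 1 : ℕ) by push_cast; ring)

theorem iterate_shiftInv_apply (N : ℕ) (x : TMC M) (i : ℤ) :
    ((shiftInv M)^[N] x).1 i = x.1 (i - N) := by
  induction N generalizing x with
  | zero => simp
  | succ k ih =>
    rw [Function.iterate_succ_apply, ih]
    exact congrArg x.1 (show i - k - 1 = i - (k + 1 : ℕ) by push_cast; ring)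

theorem bracket_apply {x y : TMC M} (h : x.1 0 = y.1 0) (i : ℤ) :
    (bracket x y).1 i = if i ≤ 0 then y.1 i else x.1 i :=
  congrFun (congrArg Subtype.val (dif_pos h)) i

theorem bracket_eq_left_iff {x y : TMC M} (h : x.1 0 = y.1 0) :
    bracket x y = x ↔ ∀ i ≤ 0, x.1 i = y.1 i := by
  constructor
  · intro hb i hi
    have := bracket_apply h i
    rwa [hb, if_pos hi] at this
  · intro hb
    refine ext_val fun i => ?_
    rw [bracket_apply h]
    split_ifs with hi
    · exact (hb i hi).symm
    · rfl

theorem bracket_eq_right_iff {x y : TMC M} (h : x.1 0 = y.1 0) :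
    bracket x y = y ↔ ∀ i ≥ 0, x.1 i = y.1 i := by
  constructor
  · intro hb i hi
    rcases hi.eq_or_lt with rfl | hi
    · exact h
    · have := bracket_apply h i
      rw [hb, if_neg (not_le.mpr hi)] at this
      exact this.symm
  · intro hb
    refine ext_val fun i => ?_
    rw [bracket_apply h]
    split_ifs with hi
    · rfl
    · exact hb i (by omega)

theorem dlam_congr (lam : ℝ) {x y x' y' : TMC M}
    (h : ∀ i, x.1 i = y.1 i ↔ x'.1 i = y'.1 i) : dlam lam x y = dlam lam x' y' := by
  simp only [dlam, h]

theorem eq_of_dlam_lt {lam : ℝ} (hlam : 1 < lam) {x y : TMC M} {k : ℕ}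
    (h : dlam lam x y < lam ^ (-(k : ℤ))) {i : ℤ} (hi : |i| ≤ k) : x.1 i = y.1 i := by
  obtain ⟨_, ⟨n, hn, rfl⟩, hlt⟩ := exists_lt_of_csInf_lt (by
    exact ⟨_, 0, fun j hj => absurd hj (not_lt.mpr (abs_nonneg j)), rfl⟩) h
  have hkn := (zpow_lt_zpow_iff_right₀ hlam).mp hlt
  exact hn i (by omega)

theorem holS_apply {N : ℕ} {c z : TMC M} (h : z.1 N = c.1 N) (i : ℤ) :
    (holS N c z).1 i = if i ≤ N then c.1 i else z.1 i := by
  have h0 : ((shift M)^[N] z).1 0 = ((shift M)^[N] c).1 0 := by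
    simpa [iterate_shift_apply] using h
  rw [holS, iterate_shiftInv_apply, bracket_apply h0]
  simp [iterate_shift_apply]

theorem eq_of_mem_locStable {lam : ℝ} (hlam : 1 < lam) {x y : TMC M}
    (h : y ∈ locStable lam x lam⁻¹) {i : ℤ} (hi : 0 ≤ i) : x.1 i = y.1 i := by
  have h0 : x.1 0 = y.1 0 := eq_of_dlam_lt hlam (k := 1) (by simpa using h.1) (by simp)
  exact (bracket_eq_right_iff h0).mp h.2 i hi

theorem eq_of_mem_locUnstable {lam : ℝ} (hlam : 1 < lam) {x y : TMC M} {k : ℕ} {ε : ℝ}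
    (hε : ε ≤ lam ^ (-(k : ℤ))) (h : y ∈ locUnstable lam x ε) {i : ℤ} (hi : i ≤ k) :
    x.1 i = y.1 i := by
  have hk : ∀ j : ℤ, |j| ≤ k → x.1 j = y.1 j := fun j hj =>
    eq_of_dlam_lt hlam (h.1.trans_le hε) hj
  rcases le_total i 0 with hi0 | hi0
  · exact ((bracket_eq_left_iff (hk 0 (by simp)).symm).mp h.2 i hi0).symm
  · exact hk i (by rwa [abs_of_nonneg hi0])

end TMC

open TMC in
/-- In a topological Markov chain with ultrametric `d_λ`, let `c₁, c₂` and
`N ≥ 0` with `σ^N(c₂) ∈ X^s(σ^N(c₁), λ⁻¹)`, and let `0 < η ≤ λ^{-N-1}`. Then the stable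
holonomy `h^s(z) = σ^{-N}[σ^N(z), σ^N(c₁)]` is well defined on `X^u(c₂,η)` (the bracket is
a genuine splice), maps `X^u(c₂,η)` into `X^u(c₁,η)`, and is an isometry. -/
theorem tmc_stable_holonomy_isometry {m : ℕ} (hm : 1 ≤ m) (M : Fin m → Fin m → Bool)
    (lam : ℝ) (hlam : 1 < lam) (c₁ c₂ : TMC M) (N : ℕ)
    (hN : (shift M)^[N] c₂ ∈ locStable lam ((shift M)^[N] c₁) lam⁻¹)
    (η : ℝ) (hη0 : 0 < η) (hη : η ≤ lam ^ (-(N : ℤ) - 1)) :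
    (∀ z ∈ locUnstable lam c₂ η,
      ((shift M)^[N] z).1 0 = ((shift M)^[N] c₁).1 0) ∧
    (∀ z ∈ locUnstable lam c₂ η, holS N c₁ z ∈ locUnstable lam c₁ η) ∧
    (∀ z ∈ locUnstable lam c₂ η, ∀ w ∈ locUnstable lam c₂ η,
      dlam lam (holS N c₁ z) (holS N c₁ w) = dlam lam z w) := by
  have hc : ∀ i : ℤ, N ≤ i → c₁.1 i = c₂.1 i := fun i hi => by
    simpa [iterate_shift_apply] using
      eq_of_mem_locStable hlam hN (i := i - N) (by omega)
  have hη' : η ≤ lam ^ (-((N + 1 : ℕ) : ℤ)) := by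
    convert hη using 2
    push_cast
    ring
  have hz : ∀ z ∈ locUnstable lam c₂ η, ∀ i : ℤ, i ≤ N → c₂.1 i = z.1 i :=
    fun z h i hi => eq_of_mem_locUnstable hlam hη' h (by push_cast; omega)
  have hzN : ∀ z ∈ locUnstable lam c₂ η, z.1 N = c₁.1 N := fun z h =>
    ((hc N le_rfl).trans (hz z h N le_rfl)).symm
  refine ⟨fun z h => by simpa [iterate_shift_apply] using hzN z h, fun z h => ⟨?_, ?_⟩,
    fun z h w h' => dlam_congr lam fun i => ?_⟩
  · refine lt_of_eq_of_lt (dlam_congr lam fun i => ?_) h.1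
    rw [holS_apply (hzN z h)]
    split_ifs with hi
    · simp [hz z h i hi]
    · rw [hc i (by omega)]
  · have heq : ∀ i ≤ (0 : ℤ), (holS N c₁ z).1 i = c₁.1 i := fun i hi => by
      rw [holS_apply (hzN z h), if_pos (by omega)]
    exact (bracket_eq_left_iff (heq 0 le_rfl)).mpr heq
  · rw [holS_apply (hzN z h), holS_apply (hzN w h')]
    split_ifs with hi
    · simp [← hz z h i hi, ← hz w h' i hi]
    · rfl
end
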